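/- Let u = (u_1,…,u_N) be a centered Gaussian random vector with covariance matrix Σ, and for each i define A(i) = {k ≤ N : Σ_{ik} ≠ 0}. Fix indices i, j and define B(i,j) as the set of indices k ≤ N such that k ∉ A(i) ∪ A(j) and there exists p ∈ A(k) with cov(u_i u_j, u_k u_p) ≠ 0. Then B(i,j) ⊆ ∪_{p ∈ A(i)∪A(j)} A(p); in particular, if max_i |A(i)| ≤ m for all i, then |B(i,j)| ≤ 2m² for all i, j, so that when m = O(1) one has max_{i,j≤N} |B(i,j)| = O(1). (Lemma D: la.6) -/

import Mathlib

open MeasureTheory Matrix ProbabilityTheory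

/-- The covariance of the products `u_i u_j` and `u_k u_p`. -/
noncomputable def cov4 {Ω : Type*} [MeasurableSpace Ω] (μ : Measure Ω)
    {N : ℕ} (u : Ω → Fin N → ℝ) (i j k p : Fin N) : ℝ :=
  (∫ ω, u ω i * u ω j * (u ω k * u ω p) ∂μ) -
    (∫ ω, u ω i * u ω j ∂μ) * (∫ ω, u ω k * u ω p ∂μ)

theorem aux_law {Ω : Type*} [MeasurableSpace Ω] (μ : Measure Ω)
    [IsProbabilityMeasure μ] {N : ℕ} (u : Ω → Fin N → ℝ)
    (hmeas : ∀ j, Measurable fun ω => u ω j)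
    (S : Matrix (Fin N) (Fin N) ℝ)
    (hgauss : ∀ a : Fin N → ℝ,
      Measure.map (fun ω => a ⬝ᵥ u ω) μ =
        gaussianReal 0 (Real.toNNReal (a ⬝ᵥ (S *ᵥ a)))) :
    HasGaussianLaw u μ := by
  have hu : Measurable u := measurable_pi_lambda _ hmeas
  refine ⟨isGaussian_of_map_eq_gaussianReal fun L => ?_⟩
  refine ⟨0, Real.toNNReal ((fun i => L (Pi.single i 1)) ⬝ᵥ
    (S *ᵥ (fun i => L (Pi.single i 1)))), ?_⟩
  · rw [Measure.map_map (by fun_prop) hu]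
    have := hgauss (fun i => L (Pi.single i 1))
    rw [← this]
    congr 1
    ext ω
    simp only [Function.comp_apply, dotProduct]
    conv_lhs => rw [← Finset.univ_sum_single (u ω), map_sum]
    refine Finset.sum_congr rfl fun i _ => ?_
    have : Pi.single i (u ω i) = u ω i • (Pi.single i 1 : Fin N → ℝ) := by
      rw [← Pi.single_smul]; simp
    rw [this, map_smul, smul_eq_mul, mul_comm]

theorem aux_cov {Ω : Type*} [MeasurableSpace Ω] (μ : Measure Ω)
    [IsProbabilityMeasure μ] {N : ℕ} (u : Ω → Fin N → ℝ)
    (hmeas : ∀ j, Measurable fun ω => u ω j)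
    (S : Matrix (Fin N) (Fin N) ℝ) (hsymm : S.IsSymm)
    (hgauss : ∀ a : Fin N → ℝ,
      Measure.map (fun ω => a ⬝ᵥ u ω) μ =
        gaussianReal 0 (Real.toNNReal (a ⬝ᵥ (S *ᵥ a))))
    (i k : Fin N) (h : S i k = 0) :
    cov[fun ω => u ω i, fun ω => u ω k; μ] = 0 := by
  have hL := aux_law μ u hmeas S hgauss
  have hm : ∀ i, MemLp (fun ω => u ω i) 2 μ := fun i =>
    (HasGaussianLaw.eval (X := fun i ω => u ω i) hL i).memLp_two
  have hu : Measurable u := measurable_pi_lambda _ hmeas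
  have hv : ∀ a : Fin N → ℝ, Var[fun ω => a ⬝ᵥ u ω; μ] = Real.toNNReal (a ⬝ᵥ (S *ᵥ a)) := by
    intro a
    rw [← variance_id_map, hgauss a, variance_id_gaussianReal]
    simp only [dotProduct]
    fun_prop
  have h' : S k i = 0 := by rw [← hsymm.apply]; exact h
  have h1 := hv (Pi.single i 1 + Pi.single k 1)
  have h2 := hv (Pi.single i 1 - Pi.single k 1)
  simp only [add_dotProduct, sub_dotProduct, mulVec_add, mulVec_sub, single_dotProduct, one_mul,
    Pi.add_apply, Pi.sub_apply, mulVec_single_one, Matrix.col_apply, h, h'] at h1 h2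
  rw [variance_fun_add (hm i) (hm k)] at h1
  rw [variance_fun_sub (hm i) (hm k)] at h2
  simp only [add_zero, zero_add, sub_zero, zero_sub, sub_neg_eq_add] at h1 h2
  linarith

theorem aux_cov4 {Ω : Type*} [MeasurableSpace Ω] (μ : Measure Ω)
    [IsProbabilityMeasure μ] {N : ℕ} (u : Ω → Fin N → ℝ)
    (hmeas : ∀ j, Measurable fun ω => u ω j)
    (S : Matrix (Fin N) (Fin N) ℝ) (hsymm : S.IsSymm)
    (hgauss : ∀ a : Fin N → ℝ,
      Measure.map (fun ω => a ⬝ᵥ u ω) μ =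
        gaussianReal 0 (Real.toNNReal (a ⬝ᵥ (S *ᵥ a))))
    (i j k p : Fin N) (hik : S i k = 0) (hjk : S j k = 0) (hip : S i p = 0) (hjp : S j p = 0) :
    cov4 μ u i j k p = 0 := by
  have hL := aux_law μ u hmeas S hgauss
  have hc := aux_cov μ u hmeas S hsymm hgauss
  let f : Fin 2 → Fin N := ![i, j]
  let g : Fin 2 → Fin N := ![k, p]
  have hind := HasGaussianLaw.indepFun_of_covariance_eval (P := μ)
    (X := fun a ω => u ω (f a)) (Y := fun a ω => u ω (g a))
    (hL.map_fun (.prod (.pi fun a => .proj (f a)) (.pi fun a => .proj (g a))))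
    (by
      intro a b
      apply hc
      fin_cases a <;> fin_cases b <;> simpa [f, g])
  have h2 := hind.comp (φ := fun x : Fin 2 → ℝ => x 0 * x 1) (ψ := fun x : Fin 2 → ℝ => x 0 * x 1)
    (by fun_prop) (by fun_prop)
  have h3 := h2.integral_fun_mul_eq_mul_integral
    (((hmeas i).mul (hmeas j)).aestronglyMeasurable)
    (((hmeas k).mul (hmeas p)).aestronglyMeasurable)
  rw [cov4, sub_eq_zero]
  exact h3

/-- **Lemma A.6.** Let `u = (u_1,…,u_N)` be a centered Gaussian vector with
covariance `S`, and put `A(i) = {k : S_{ik} ≠ 0}`. For fixed `i, j` let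
`B(i,j)` be the set of `k ∉ A(i) ∪ A(j)` such that `cov(u_i u_j, u_k u_p) ≠ 0`
for some `p ∈ A(k)`. Then `B(i,j) ⊆ ⋃_{p ∈ A(i) ∪ A(j)} A(p)`; in particular,
if `|A(i)| ≤ m` for every `i`, then `|B(i,j)| ≤ 2 m²` for all `i, j`. -/
theorem lemma_a6 {Ω : Type*} [MeasurableSpace Ω] (μ : Measure Ω)
    [IsProbabilityMeasure μ] {N : ℕ} (u : Ω → Fin N → ℝ)
    (hmeas : ∀ j, Measurable fun ω => u ω j)
    (S : Matrix (Fin N) (Fin N) ℝ) (hsymm : S.IsSymm)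
    -- `u ~ N(0, S)`: every linear functional of `u` is `N(0, a'Sa)`
    (hgauss : ∀ a : Fin N → ℝ,
      Measure.map (fun ω => a ⬝ᵥ u ω) μ =
        gaussianReal 0 (Real.toNNReal (a ⬝ᵥ (S *ᵥ a))))
    (A : Fin N → Set (Fin N)) (hA : ∀ i, A i = {k | S i k ≠ 0})
    (B : Fin N → Fin N → Set (Fin N))
    (hB : ∀ i j, B i j = {k | k ∉ A i ∪ A j ∧
      ∃ p ∈ A k, cov4 μ u i j k p ≠ 0}) :
    (∀ i j, B i j ⊆ ⋃ p ∈ A i ∪ A j, A p) ∧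
    (∀ m : ℕ, (∀ i, (A i).ncard ≤ m) →
      ∀ i j, (B i j).ncard ≤ 2 * m ^ 2) := by
  have main : ∀ i j, B i j ⊆ ⋃ p ∈ A i ∪ A j, A p := by
    intro i j k hk
    rw [hB] at hk
    obtain ⟨hk, p, hp, hne⟩ := hk
    simp only [hA, Set.mem_union, Set.mem_ofPred_eq, not_or, not_not] at hk hp
    by_contra hcon
    simp only [hA, Set.mem_iUnion, Set.mem_union, Set.mem_ofPred_eq, not_exists, exists_prop,
      not_and] at hcon
    have hpk : S p k ≠ 0 := by rwa [← hsymm.apply]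
    have h : ¬ (S i p ≠ 0 ∨ S j p ≠ 0) := fun hh => hcon p hh hpk
    rw [not_or, ne_eq, ne_eq, not_not, not_not] at h
    exact hne (aux_cov4 μ u hmeas S hsymm hgauss i j k p hk.1 hk.2 h.1 h.2)
  refine ⟨main, fun m hm i j => ?_⟩
  classical
  have h1 : (B i j).ncard ≤ (⋃ p ∈ A i ∪ A j, A p).ncard :=
    Set.ncard_le_ncard (main i j) (Set.toFinite _)
  have h2 : (⋃ p ∈ A i ∪ A j, A p) =
      (((A i ∪ A j).toFinset.biUnion fun p => (A p).toFinset : Finset (Fin N)) : Set (Fin N)) := by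
    ext x; simp
  rw [h2, Set.ncard_coe_finset] at h1
  have h3 := Finset.card_biUnion_le_card_mul (A i ∪ A j).toFinset (fun p => (A p).toFinset) m
    (fun p _ => by rw [← Set.ncard_eq_toFinset_card']; exact hm p)
  rw [← Set.ncard_eq_toFinset_card'] at h3
  have h4 := Set.ncard_union_le (A i) (A j)
  have h5 := hm i
  have h6 := hm j
  calc _ ≤ _ := h1
    _ ≤ _ := h3
    _ ≤ (m + m) * m := Nat.mul_le_mul_right _ (by omega)
    _ = 2 * m ^ 2 := by ring
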